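/- Suppose m divides n with 2 ≤ m ≤ n. Let E^{(n)} := (A^{(n)}#C_n)/(e₀) and E^{(m)} := (A^{(m)}#C_m)/(e₀) be the corresponding quotient algebras for n and m variables respectively. Then GKdim E^{(n)} ≥ GKdim E^{(m)}. In particular, if E^{(n)} is finite-dimensional over k then so is E^{(m)}. -/

import Mathlib

open scoped BigOperators

namespace NCIS

variable (k : Type*) [Field k] (n : ℕ)

/-- Relations defining the skew group algebra `A # C_n`, where
`A = k_{-1}[x_0, …, x_{n-1}]`: the generators are `x_i` (`Sum.inl i`) and `s` (`Sum.inr ()`),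
subject to `x_i x_j + x_j x_i = 0` for `i ≠ j`, `s^n = 1` and `s x_i = x_{i+1} s`. -/
inductive SGRel : FreeAlgebra k (ZMod n ⊕ Unit) → FreeAlgebra k (ZMod n ⊕ Unit) → Prop
  | anti (i j : ZMod n) (h : i ≠ j) :
      SGRel (FreeAlgebra.ι k (Sum.inl i) * FreeAlgebra.ι k (Sum.inl j)
           + FreeAlgebra.ι k (Sum.inl j) * FreeAlgebra.ι k (Sum.inl i)) 0
  | spow : SGRel (FreeAlgebra.ι k (Sum.inr ()) ^ n) 1
  | scomm (i : ZMod n) :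
      SGRel (FreeAlgebra.ι k (Sum.inr ()) * FreeAlgebra.ι k (Sum.inl i))
            (FreeAlgebra.ι k (Sum.inl (i + 1)) * FreeAlgebra.ι k (Sum.inr ()))

/-- The skew group algebra `A # C_n`. -/
abbrev SkewGroup := RingQuot (SGRel k n)

/-- The image of the generator `x_i` in `A # C_n`. -/
noncomputable def xg (i : ZMod n) : SkewGroup k n :=
  RingQuot.mkAlgHom k (SGRel k n) (FreeAlgebra.ι k (Sum.inl i))

/-- The image of the generator `s` in `A # C_n`. -/
noncomputable def sg : SkewGroup k n :=
  RingQuot.mkAlgHom k (SGRel k n) (FreeAlgebra.ι k (Sum.inr ()))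

/-- The integral `e₀ = (1/n) ∑_{i=0}^{n-1} s^i` in `A # C_n`. -/
noncomputable def e0 : SkewGroup k n := (n : k)⁻¹ • ∑ i ∈ Finset.range n, sg k n ^ i

/-- The quotient algebra `E = (A # C_n)/(e₀)` of `A # C_n` by the two-sided ideal
generated by `e₀`. -/
abbrev Equot := RingQuot (fun a b : SkewGroup k n => a = e0 k n ∧ b = 0)

end NCIS

namespace NCIS

variable (k : Type*) [Field k] (n : ℕ)

/-- The Gelfand–Kirillov dimension of an algebra `B` with respect to a generating
subspace `V ∋ 1`:  `limsup_{m → ∞} log(dim_k V^m) / log m`, where `V^m` is the span of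
all products of `m` elements of `V` (which, since `1 ∈ V`, is the span of all products of
at most `m` elements of `V`). -/
noncomputable def gkdim (B : Type*) [Ring B] [Algebra k B] (V : Submodule k B) : ℝ :=
  Filter.limsup
    (fun m : ℕ => Real.log (Module.finrank k (V ^ m : Submodule k B)) / Real.log m)
    Filter.atTop

/-- The standard generating subspace of `E = (A#C_n)/(e₀)`: the span of `1` and of the
images of `x_0, …, x_{n-1}` and `s`. -/
noncomputable def Vgen : Submodule k (Equot k n) :=
  Submodule.span k
    (insert (1 : Equot k n)
      (insert (RingQuot.mkAlgHom k (fun a b : SkewGroup k n => a = e0 k n ∧ b = 0) (sg k n))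
        (Set.range (fun i : ZMod n =>
          RingQuot.mkAlgHom k (fun a b : SkewGroup k n => a = e0 k n ∧ b = 0) (xg k n i)))))

end NCIS

namespace NCIS

section Growth

variable {k B : Type*} [Field k] [Ring B] [Algebra k B] {n : ℕ}

/-- Elements `x_i` and `s` of a ring satisfy the relations of `(A # C_n)/(e₀)`. -/
structure SatisfiesRel (x : ZMod n → B) (s : B) : Prop where
  anti : ∀ i j, i ≠ j → x i * x j + x j * x i = 0
  spow : s ^ n = 1
  scomm : ∀ i, s * x i = x (i + 1) * s
  ssum : ∑ i ∈ Finset.range n, s ^ i = 0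

variable (k) in
/-- The span of `1`, `s` and the `x_i`. -/
def genSpan (x : ZMod n → B) (s : B) : Submodule k B :=
  Submodule.span k (insert 1 (insert s (Set.range x)))

theorem one_mem_genSpan (x : ZMod n → B) (s : B) : 1 ∈ genSpan k x s :=
  Submodule.subset_span (Set.mem_insert _ _)

theorem s_mem_genSpan (x : ZMod n → B) (s : B) : s ∈ genSpan k x s :=
  Submodule.subset_span (Set.mem_insert_of_mem _ (Set.mem_insert _ _))

theorem x_mem_genSpan (x : ZMod n → B) (s : B) (i : ZMod n) : x i ∈ genSpan k x s :=
  Submodule.subset_span (Set.mem_insert_of_mem _ (Set.mem_insert_of_mem _ ⟨i, rfl⟩))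

theorem one_le_genSpan (x : ZMod n → B) (s : B) : 1 ≤ genSpan k x s :=
  Submodule.one_le.mpr (one_mem_genSpan x s)

variable {x : ZMod n → B} {s : B}

namespace SatisfiesRel

theorem s_pow_mul_x (h : SatisfiesRel x s) (b : ℕ) (i : ZMod n) :
    s ^ b * x i = x (i + b) * s ^ b := by
  induction b generalizing i with
  | zero => simp
  | succ b ih =>
    rw [pow_succ, mul_assoc, h.scomm, ← mul_assoc, ih, mul_assoc]
    congr 2
    push_cast
    ring

theorem x_pow_mul_x (h : SatisfiesRel x s) {i j : ZMod n} (hij : i ≠ j) (a : ℕ) :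
    x i ^ a * x j = (-1 : k) ^ a • (x j * x i ^ a) := by
  induction a with
  | zero => simp
  | succ a ih =>
    rw [pow_succ, mul_assoc, eq_neg_of_add_eq_zero_left (h.anti i j hij), mul_neg, ← mul_assoc,
      ih, pow_succ]
    simp [mul_assoc]

end SatisfiesRel

/-- The monomial in the `x_i` with exponents `a`, multiplied in the order of the list `L`. -/
def monomialProd (x : ZMod n → B) (L : List (ZMod n)) (a : ZMod n → ℕ) : B :=
  (L.map fun i => x i ^ a i).prod

namespace SatisfiesRel

variable (k)

theorem monomialProd_mul_x_of_notMem (h : SatisfiesRel x s) {L : List (ZMod n)} {j : ZMod n}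
    (hj : j ∉ L) (a : ZMod n → ℕ) :
    ∃ ε : k, monomialProd x L a * x j = ε • (x j * monomialProd x L a) := by
  induction L with
  | nil => exact ⟨1, by simp [monomialProd]⟩
  | cons i L ih =>
    simp only [List.mem_cons, not_or] at hj
    obtain ⟨ε, hε⟩ := ih hj.2
    refine ⟨ε * (-1) ^ a i, ?_⟩
    simp only [monomialProd, List.map_cons, List.prod_cons] at hε ⊢
    rw [mul_assoc, hε, mul_smul_comm, ← mul_assoc, h.x_pow_mul_x (k := k) (Ne.symm hj.1),
      smul_mul_assoc, smul_smul, mul_assoc]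

theorem monomialProd_mul_x (h : SatisfiesRel x s) {L : List (ZMod n)} (hL : L.Nodup)
    {j : ZMod n} (hj : j ∈ L) (a : ZMod n → ℕ) :
    ∃ ε : k, monomialProd x L a * x j
      = ε • monomialProd x L (Function.update a j (a j + 1)) := by
  induction L with
  | nil => simp at hj
  | cons i L ih =>
    obtain ⟨hi, hL⟩ := List.nodup_cons.mp hL
    by_cases hij : j = i
    · subst hij
      obtain ⟨ε, hε⟩ := h.monomialProd_mul_x_of_notMem k hi a
      have hcongr : monomialProd x L (Function.update a j (a j + 1)) = monomialProd x L a := by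
        unfold monomialProd
        congr 1
        refine List.map_congr_left fun l hl => ?_
        have hlj : l ≠ j := by rintro rfl; exact hi hl
        rw [Function.update_of_ne hlj]
      refine ⟨ε, ?_⟩
      simp only [monomialProd, List.map_cons, List.prod_cons, Function.update_self]
        at hε hcongr ⊢
      rw [hcongr, mul_assoc, hε, mul_smul_comm, pow_succ, mul_assoc]
    · obtain ⟨ε, hε⟩ := ih hL ((List.mem_cons.mp hj).resolve_left hij)
      refine ⟨ε, ?_⟩
      simp only [monomialProd, List.map_cons, List.prod_cons,
        Function.update_of_ne (Ne.symm hij)] at hε ⊢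
      rw [mul_assoc, hε, mul_smul_comm]

theorem genSpan_pow_le_span [NeZero n] (h : SatisfiesRel x s) (r : ℕ) :
    genSpan k x s ^ r ≤ Submodule.span k {y | ∃ (a : ZMod n → ℕ) (b : ℕ), (∀ i, a i ≤ r) ∧
      y = monomialProd x Finset.univ.toList a * s ^ b} := by
  induction r with
  | zero =>
    rw [pow_zero, Submodule.one_le]
    exact Submodule.subset_span ⟨0, 0, by simp, by simp [monomialProd]⟩
  | succ r ih =>
    rw [pow_succ]
    refine (mul_le_mul' ih le_rfl).trans ?_
    rw [genSpan, Submodule.span_mul_span, Submodule.span_le]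
    rintro _ ⟨_, ⟨a, b, hab, rfl⟩, _, (rfl | rfl | ⟨i, rfl⟩), rfl⟩
    · exact Submodule.subset_span ⟨a, b, fun i => (hab i).trans r.le_succ, by simp⟩
    · exact Submodule.subset_span
        ⟨a, b + 1, fun i => (hab i).trans r.le_succ, by simp [pow_succ, mul_assoc]⟩
    · obtain ⟨ε, hε⟩ := h.monomialProd_mul_x k (Finset.nodup_toList Finset.univ)
        (j := i + b) (by simp) a
      simp only [SetLike.mem_coe]
      rw [mul_assoc, h.s_pow_mul_x, ← mul_assoc, hε, smul_mul_assoc]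
      refine Submodule.smul_mem _ _ (Submodule.subset_span ⟨_, b, fun l => ?_, rfl⟩)
      rcases eq_or_ne l (i + b) with rfl | hl
      · simpa using hab _
      · simpa [hl] using (hab l).trans r.le_succ

theorem finrank_genSpan_pow_le [NeZero n] (h : SatisfiesRel x s) (r : ℕ) :
    Module.finrank k (genSpan k x s ^ r : Submodule k B) ≤ (r + 1) ^ n * n := by
  let F : (ZMod n → Fin (r + 1)) × Fin n → B := fun p =>
    monomialProd x Finset.univ.toList (fun i => p.1 i) * s ^ (p.2 : ℕ)
  have hle : genSpan k x s ^ r ≤ Submodule.span k (Set.range F) := by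
    refine (h.genSpan_pow_le_span k r).trans (Submodule.span_mono ?_)
    rintro _ ⟨a, b, hab, rfl⟩
    refine ⟨(fun i => ⟨a i, Nat.lt_succ_of_le (hab i)⟩, ⟨b % n, Nat.mod_lt _ (NeZero.pos n)⟩), ?_⟩
    simp only [F]
    rw [← pow_eq_pow_mod b h.spow]
  have hfin : FiniteDimensional k (Submodule.span k (Set.range F)) :=
    FiniteDimensional.span_of_finite k (Set.finite_range F)
  calc _ ≤ Module.finrank k (Submodule.span k (Set.range F)) := Submodule.finrank_mono hle
    _ ≤ Fintype.card ((ZMod n → Fin (r + 1)) × Fin n) := finrank_range_le_card F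
    _ = (r + 1) ^ n * n := by simp [ZMod.card]

theorem log_finrank_div_log_le [NeZero n] (h : SatisfiesRel x s) {r : ℕ} (h2 : 2 ≤ r)
    (hr : n ≤ r) :
    Real.log (Module.finrank k (genSpan k x s ^ r : Submodule k B)) / Real.log r
      ≤ 2 * n + 1 := by
  have hlog : 0 < Real.log r := Real.log_pos (by exact_mod_cast h2)
  rw [div_le_iff₀ hlog]
  rcases Nat.eq_zero_or_pos
    (Module.finrank k (genSpan k x s ^ r : Submodule k B)) with h0 | hpos
  · rw [h0]
    simp only [Nat.cast_zero, Real.log_zero]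
    positivity
  · have hle : Module.finrank k (genSpan k x s ^ r : Submodule k B) ≤ r ^ (2 * n + 1) := by
      calc _ ≤ (r + 1) ^ n * n := h.finrank_genSpan_pow_le k r
        _ ≤ (r ^ 2) ^ n * r := by gcongr; nlinarith
        _ = r ^ (2 * n + 1) := by rw [← pow_mul, pow_succ r (2 * n)]
    calc _ ≤ Real.log ((r : ℝ) ^ (2 * n + 1)) :=
          Real.log_le_log (by exact_mod_cast hpos) (by exact_mod_cast hle)
      _ = (2 * n + 1) * Real.log r := by rw [Real.log_pow]; push_cast; ring

end SatisfiesRel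

theorem finiteDimensional_genSpan_pow [NeZero n] (x : ZMod n → B) (s : B) (r : ℕ) :
    FiniteDimensional k (genSpan k x s ^ r : Submodule k B) := by
  have hV : (genSpan k x s).FG :=
    Submodule.fg_span (((Set.finite_range _).insert _).insert _)
  exact Module.Finite.iff_fg.mpr (hV.pow r)

end Growth

section Induction

variable {R : Type*} [Ring R] {d : ℕ}

/-- The matrix by which the generator of the larger cyclic group acts on the module induced from
the subgroup of index `d`, whose generator acts by `s`. -/
def shiftMatrix (d : ℕ) (s : R) : Matrix (Fin d) (Fin d) R :=
  Matrix.of fun a b =>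
    if (a : ℕ) = b + 1 then 1 else if (a : ℕ) = 0 ∧ (b : ℕ) + 1 = d then s else 0

theorem shiftMatrix_mul_single (s : R) (c b : Fin d) (a : R) (h : (c : ℕ) + 1 < d) :
    shiftMatrix d s * Matrix.single c b a = Matrix.single ⟨c + 1, h⟩ b a := by
  ext i j
  by_cases hj : j = b
  · subst hj
    simp only [Matrix.mul_single_apply_same, Matrix.single_apply, shiftMatrix, Matrix.of_apply,
      Fin.ext_iff, and_true]
    split_ifs <;> first | omega | simp
  · rw [Matrix.mul_single_apply_of_ne _ _ _ _ _ hj, Matrix.single_apply, if_neg]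
    exact fun h => hj h.2.symm

theorem shiftMatrix_mul_single_last (s : R) (c b : Fin d) (a : R) (h : (c : ℕ) + 1 = d) :
    shiftMatrix d s * Matrix.single c b a = Matrix.single ⟨0, c.pos⟩ b (s * a) := by
  ext i j
  by_cases hj : j = b
  · subst hj
    simp only [Matrix.mul_single_apply_same, Matrix.single_apply, shiftMatrix, Matrix.of_apply,
      Fin.ext_iff, and_true]
    have := i.isLt
    split_ifs <;> first | omega | simp
  · rw [Matrix.mul_single_apply_of_ne _ _ _ _ _ hj, Matrix.single_apply, if_neg]
    exact fun h => hj h.2.symm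

theorem single_mul_shiftMatrix (s : R) (c b : Fin d) (a : R) (h : (c : ℕ) + 1 < d) :
    Matrix.single b ⟨c + 1, h⟩ a * shiftMatrix d s = Matrix.single b c a := by
  ext i j
  by_cases hi : i = b
  · subst hi
    simp only [Matrix.single_mul_apply_same, Matrix.single_apply, shiftMatrix, Matrix.of_apply,
      Fin.ext_iff, true_and]
    split_ifs <;> first | omega | simp_all
  · rw [Matrix.single_mul_apply_of_ne _ _ _ _ _ hi, Matrix.single_apply, if_neg]
    exact fun h => hi h.1.symm

theorem single_mul_shiftMatrix_last (s : R) (c b : Fin d) (a : R) (h : (c : ℕ) + 1 = d) :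
    Matrix.single b ⟨0, c.pos⟩ a * shiftMatrix d s = Matrix.single b c (a * s) := by
  ext i j
  by_cases hi : i = b
  · subst hi
    simp only [Matrix.single_mul_apply_same, Matrix.single_apply, shiftMatrix, Matrix.of_apply,
      Fin.ext_iff, true_and]
    split_ifs <;> first | contradiction | omega | simp
  · rw [Matrix.single_mul_apply_of_ne _ _ _ _ _ hi, Matrix.single_apply, if_neg]
    exact fun h => hi h.1.symm

theorem shiftMatrix_pow_mul_single (s : R) (b : Fin d) (a : R) (t : ℕ) (ht : t < d) :
    shiftMatrix d s ^ t * Matrix.single ⟨0, b.pos⟩ b a = Matrix.single ⟨t, ht⟩ b a := by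
  induction t with
  | zero => simp
  | succ t ih =>
    rw [pow_succ', mul_assoc, ih (by omega), shiftMatrix_mul_single _ _ _ _ ht]

theorem shiftMatrix_pow (s : R) :
    shiftMatrix d s ^ d = Matrix.diagonal fun _ => s := by
  have hcol (c : Fin d) :
      shiftMatrix d s ^ d * Matrix.single c c 1 = Matrix.single c c s := by
    have hpos := c.pos
    have hzero : shiftMatrix d s ^ d * Matrix.single ⟨0, hpos⟩ c 1
        = Matrix.single ⟨0, hpos⟩ c s := by
      obtain ⟨e, rfl⟩ : ∃ e, d = e + 1 := ⟨d - 1, by omega⟩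
      rw [pow_succ', mul_assoc, shiftMatrix_pow_mul_single s c 1 e (by omega),
        shiftMatrix_mul_single_last _ _ _ _ rfl, mul_one]
    rw [← shiftMatrix_pow_mul_single s c 1 c c.isLt, ← mul_assoc, ← pow_add, add_comm, pow_add,
      mul_assoc, hzero, shiftMatrix_pow_mul_single s c s c c.isLt]
  calc shiftMatrix d s ^ d = shiftMatrix d s ^ d * ∑ c, Matrix.single c c 1 := by
        rw [Matrix.sum_single_one, mul_one]
    _ = ∑ c, Matrix.single c c s := by simp only [Finset.mul_sum, hcol]
    _ = _ := Matrix.sum_single_eq_diagonal _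

theorem sum_shiftMatrix_pow (s : R) (m : ℕ) (hs : ∑ i ∈ Finset.range m, s ^ i = 0) :
    ∑ i ∈ Finset.range (d * m), shiftMatrix d s ^ i = 0 := by
  have hd : ∑ j ∈ Finset.range m, (shiftMatrix d s ^ d) ^ j = 0 := by
    rw [shiftMatrix_pow]
    ext a b
    rw [Matrix.sum_apply]
    simp only [Matrix.diagonal_pow, Matrix.diagonal_apply, Pi.pow_apply]
    split_ifs <;> simp [hs]
  have hsum : ∑ i ∈ Finset.range (d * m), shiftMatrix d s ^ i
      = (∑ c ∈ Finset.range d, shiftMatrix d s ^ c) *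
        ∑ j ∈ Finset.range m, (shiftMatrix d s ^ d) ^ j := by
    clear hd hs
    induction m with
    | zero => simp
    | succ m ih =>
      rw [Nat.mul_succ, Finset.sum_range_succ _ m, mul_add, ← ih, Finset.sum_range_add,
        Finset.sum_mul]
      simp only [← pow_mul, ← pow_add, add_comm]
  rw [hsum, hd, mul_zero]

/-- The action of the `x_i` on the induced module. -/
def inducedX {m : ℕ} (hd : 0 < d) (x : ZMod m → R) (i : ZMod (d * m)) :
    Matrix (Fin d) (Fin d) R :=
  Matrix.single ⟨i.val % d, Nat.mod_lt _ hd⟩ ⟨i.val % d, Nat.mod_lt _ hd⟩ (x (i.val / d : ℕ))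

theorem SatisfiesRel.induced {m : ℕ} {x : ZMod m → R} {s : R} (hrel : SatisfiesRel x s)
    (hd : 0 < d) (hm : 0 < m) : SatisfiesRel (inducedX hd x) (shiftMatrix d s) where
  anti i j hij := by
    have : NeZero (d * m) := ⟨(Nat.mul_pos hd hm).ne'⟩
    unfold inducedX
    by_cases hmod : i.val % d = j.val % d
    · have hdiv : ((i.val / d : ℕ) : ZMod m) ≠ (j.val / d : ℕ) := by
        intro h
        rw [ZMod.natCast_eq_natCast_iff] at h
        have h' := Nat.ModEq.eq_of_lt_of_lt h (Nat.div_lt_of_lt_mul i.val_lt)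
          (Nat.div_lt_of_lt_mul j.val_lt)
        refine hij (ZMod.val_injective _ ?_)
        rw [← Nat.div_add_mod i.val d, h', hmod, Nat.div_add_mod]
      simp only [hmod, Matrix.single_mul_single_same, ← Matrix.single_add]
      rw [hrel.anti _ _ hdiv, Matrix.single_zero]
    · rw [Matrix.single_mul_single_of_ne, Matrix.single_mul_single_of_ne, add_zero]
      · simpa [Fin.ext_iff] using Ne.symm hmod
      · simpa [Fin.ext_iff] using hmod
  spow := by
    rw [pow_mul, shiftMatrix_pow, Matrix.diagonal_pow]
    ext a b
    simp [Matrix.diagonal_apply, Matrix.one_apply, hrel.spow]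
  scomm i := by
    have : NeZero (d * m) := ⟨(Nat.mul_pos hd hm).ne'⟩
    unfold inducedX
    have hval : (i + 1).val = (i.val + 1) % (d * m) := by
      rw [ZMod.val_add, ZMod.val_one_eq_one_mod, Nat.add_mod_mod]
    have hmod : (i + 1).val % d = (i.val + 1) % d := by
      rw [hval, Nat.mod_mul_right_mod]
    have hdiv : (((i + 1).val / d : ℕ) : ZMod m) = ((i.val + 1) / d : ℕ) := by
      rw [hval, ZMod.natCast_eq_natCast_iff, Nat.mod_mul_right_div_self]
      exact Nat.mod_modEq _ _
    have hlt := Nat.mod_lt i.val hd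
    rw [hdiv]
    simp only [hmod]
    rcases Nat.lt_or_ge (i.val % d + 1) d with h | h
    · have h1 : (i.val + 1) % d = i.val % d + 1 := by
        rw [Nat.add_mod, Nat.mod_eq_of_lt (show 1 < d by omega), Nat.mod_eq_of_lt h]
      have h2 : (i.val + 1) / d = i.val / d := by
        rw [Nat.succ_div_of_not_dvd]
        rw [Nat.dvd_iff_mod_eq_zero]
        omega
      simp only [h1, h2]
      rw [shiftMatrix_mul_single _ _ _ _ h]
      exact (single_mul_shiftMatrix _ ⟨i.val % d, hlt⟩ _ _ h).symm
    · have h0 : i.val % d + 1 = d := by omega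
      have hdvd : d ∣ i.val + 1 :=
        ⟨i.val / d + 1, by rw [mul_add, mul_one]; have := Nat.div_add_mod i.val d; omega⟩
      have h1 : (i.val + 1) % d = 0 := Nat.mod_eq_zero_of_dvd hdvd
      have h2 : (i.val + 1) / d = i.val / d + 1 := Nat.succ_div_of_dvd hdvd
      simp only [h1, h2]
      rw [shiftMatrix_mul_single_last _ _ _ _ h0, hrel.scomm]
      push_cast
      exact (single_mul_shiftMatrix_last _ ⟨i.val % d, hlt⟩ _ _ h0).symm
  ssum := sum_shiftMatrix_pow _ _ hrel.ssum

end Induction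

section Comparison

variable {k B C : Type*} [Field k] [Ring B] [Algebra k B] [Ring C] [Algebra k C]

/-- If an algebra `C` acts on the induced module of `B`, some linear map from `C` to `B` has the
property that the image of the `dr`-th filtration step of `C` contains the `r`-th filtration step
of `B`. -/
theorem exists_linearMap_genSpan_pow_le {d m : ℕ} (hd : 0 < d) (hm : 0 < m)
    {x : ZMod m → B} {s : B} {X : ZMod (d * m) → C} {S : C}
    (φ : C →ₐ[k] Matrix (Fin d) (Fin d) B) (hs : φ S = shiftMatrix d s)
    (hx : ∀ i, φ (X i) = inducedX hd x i) :
    ∃ ℓ : C →ₗ[k] B, ∀ r, genSpan k x s ^ r ≤ (genSpan k X S ^ (d * r)).map ℓ := by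
  have : NeZero m := ⟨hm.ne'⟩
  let z : Fin d := ⟨0, hd⟩
  have hone : (1 : Submodule k (C)) ≤ genSpan k X S :=
    one_le_genSpan X S
  have hcol (w : B) : Matrix.single z z 1 * Matrix.single z z w = Matrix.single z z w := by
    rw [Matrix.single_mul_single_same, one_mul]
  have hgen (w) (hw : w ∈ genSpan k x s) : ∃ W ∈ genSpan k X S ^ d,
      φ W * Matrix.single z z 1 = Matrix.single z z w := by
    rw [genSpan] at hw
    induction hw using Submodule.span_induction with
    | mem w hw =>
      rcases hw with rfl | rfl | ⟨j, rfl⟩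
      · exact ⟨1, Submodule.one_le.mp (one_le_pow_of_one_le' hone d), by simp⟩
      · refine ⟨S ^ d, Submodule.pow_mem_pow _ (s_mem_genSpan X S) d, ?_⟩
        rw [map_pow, hs, shiftMatrix_pow, ← Matrix.smul_eq_diagonal_mul, Matrix.smul_single,
          smul_eq_mul, mul_one]
      · have hval : ((d * j.val : ℕ) : ZMod (d * m)).val = d * j.val :=
          ZMod.val_natCast_of_lt (Nat.mul_lt_mul_of_pos_left j.val_lt hd)
        refine ⟨X (d * j.val : ℕ),
          le_self_pow hone hd.ne' (x_mem_genSpan X S _), ?_⟩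
        rw [hx, inducedX]
        simp only [hval, Nat.mul_mod_right, Nat.mul_div_cancel_left _ hd, ZMod.natCast_val,
          ZMod.cast_id', id_eq]
        rw [Matrix.single_mul_single_same, mul_one]
    | zero => exact ⟨0, zero_mem _, by simp⟩
    | add v w _ _ hv hw =>
      obtain ⟨V, hV, hφV⟩ := hv
      obtain ⟨W, hW, hφW⟩ := hw
      exact ⟨V + W, add_mem hV hW, by rw [map_add, add_mul, hφV, hφW, Matrix.single_add]⟩
    | smul c w _ hw =>
      obtain ⟨W, hW, hφW⟩ := hw
      exact ⟨c • W, Submodule.smul_mem _ _ hW, by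
        rw [map_smul, smul_mul_assoc, hφW, Matrix.smul_single]⟩
  have hpow (r) : ∀ w ∈ genSpan k x s ^ r, ∃ W ∈ genSpan k X S ^ (d * r),
      φ W * Matrix.single z z 1 = Matrix.single z z w := by
    induction r with
    | zero =>
      intro w hw
      obtain ⟨c, rfl⟩ := Submodule.mem_one.mp (pow_zero (genSpan k x s) ▸ hw)
      refine ⟨algebraMap k _ c, ?_, ?_⟩
      · rw [mul_zero, pow_zero]
        exact Submodule.mem_one.mpr ⟨c, rfl⟩
      · rw [Algebra.algebraMap_eq_smul_one, Algebra.algebraMap_eq_smul_one, map_smul, map_one,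
          smul_mul_assoc, one_mul, Matrix.smul_single]
    | succ r ih =>
      intro w hw
      rw [pow_succ] at hw
      induction hw using Submodule.mul_induction_on' with
      | mem_mul_mem v hv w hw =>
        obtain ⟨V, hV, hφV⟩ := ih v hv
        obtain ⟨W, hW, hφW⟩ := hgen w hw
        refine ⟨V * W, ?_, ?_⟩
        · rw [mul_add, mul_one, pow_add]
          exact Submodule.mul_mem_mul hV hW
        · rw [map_mul, mul_assoc, hφW, ← hcol w, ← mul_assoc, hφV,
            Matrix.single_mul_single_same]
      | add v _ w _ hv hw =>
        obtain ⟨V, hV, hφV⟩ := hv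
        obtain ⟨W, hW, hφW⟩ := hw
        exact ⟨V + W, add_mem hV hW, by rw [map_add, add_mul, hφV, hφW, Matrix.single_add]⟩
  refine ⟨Matrix.entryLinearMap k _ z z ∘ₗ φ.toLinearMap, fun r w hw => ?_⟩
  obtain ⟨W, hW, hφW⟩ := hpow r w hw
  refine ⟨W, hW, ?_⟩
  simpa using congrFun (congrFun hφW z) z

end Comparison

open Filter Topology in
/-- Comparison of growth exponents of two sequences, the second one being rescaled. -/
theorem limsup_log_div_log_le {f g : ℕ → ℕ} {d : ℕ} (hd : 0 < d) (hfg : ∀ r, f r ≤ g (d * r))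
    (hg : IsBoundedUnder (· ≤ ·) atTop fun r : ℕ => Real.log (g r) / Real.log r) :
    limsup (fun r : ℕ => Real.log (f r) / Real.log r) atTop
      ≤ limsup (fun r : ℕ => Real.log (g r) / Real.log r) atTop := by
  refine le_of_forall_gt_imp_ge_of_dense fun c hc => ?_
  have hlt : ∀ᶠ r : ℕ in atTop, Real.log (g r) / Real.log r < c := eventually_lt_of_limsup_lt hc hg
  have hmul : Tendsto (fun r : ℕ => d * r) atTop atTop := tendsto_id.const_mul_atTop' hd
  have hlog : Tendsto (fun r : ℕ => Real.log r) atTop atTop :=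
    Real.tendsto_log_atTop.comp tendsto_natCast_atTop_atTop
  have hlim : Tendsto (fun r : ℕ => c * (Real.log d / Real.log r + 1)) atTop (𝓝 c) := by
    simpa using ((hlog.const_div_atTop (Real.log d)).add_const 1).const_mul c
  rw [← hlim.limsup_eq]
  refine limsup_le_limsup ?_ ?_ hlim.isBoundedUnder_le
  · filter_upwards [hmul.eventually hlt, eventually_ge_atTop 2] with r hr h2
    have hlogr : 0 < Real.log r := Real.log_pos (by exact_mod_cast h2)
    have hlogdr : Real.log (d * r : ℕ) = Real.log d + Real.log r := by
      rw [Nat.cast_mul, Real.log_mul (by positivity) (by positivity)]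
    have hd0 : 0 ≤ Real.log d := Real.log_natCast_nonneg d
    rw [hlogdr, div_lt_iff₀ (by positivity)] at hr
    rw [div_le_iff₀ hlogr, mul_assoc, add_mul, div_mul_cancel₀ _ hlogr.ne', one_mul]
    refine le_trans ?_ hr.le
    rcases Nat.eq_zero_or_pos (f r) with h0 | hpos
    · rw [h0]
      simpa using Real.log_natCast_nonneg (g (d * r))
    · exact Real.log_le_log (by exact_mod_cast hpos) (by exact_mod_cast hfg r)
  · refine IsBoundedUnder.isCoboundedUnder_le ⟨0, ?_⟩
    exact eventually_map.mpr (.of_forall fun r =>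
      div_nonneg (Real.log_natCast_nonneg _) (Real.log_natCast_nonneg _))


theorem gkdim_le_of_inducedRepresentation {k B C : Type*} [Field k] [Ring B] [Algebra k B]
    [Ring C] [Algebra k C] {d m : ℕ} (hd : 0 < d) (hm : 0 < m)
    {x : ZMod m → B} {s : B} {X : ZMod (d * m) → C} {S : C} (hXS : SatisfiesRel X S)
    (hB : ∀ w, ∃ r, w ∈ genSpan k x s ^ r)
    (φ : C →ₐ[k] Matrix (Fin d) (Fin d) B) (hs : φ S = shiftMatrix d s)
    (hx : ∀ i, φ (X i) = inducedX hd x i) :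
    gkdim k B (genSpan k x s) ≤ gkdim k C (genSpan k X S) ∧
      (FiniteDimensional k C → FiniteDimensional k B) := by
  have : NeZero (d * m) := ⟨(Nat.mul_pos hd hm).ne'⟩
  obtain ⟨ℓ, hℓ⟩ := exists_linearMap_genSpan_pow_le hd hm φ hs hx
  refine ⟨limsup_log_div_log_le hd (fun r => ?_) ?_, fun hfin => ?_⟩
  · have := finiteDimensional_genSpan_pow (k := k) X S (d * r)
    exact (Submodule.finrank_mono (hℓ r)).trans (Submodule.finrank_map_le ℓ _)
  · refine ⟨2 * (d * m : ℕ) + 1, Filter.eventually_map.mpr ?_⟩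
    filter_upwards [Filter.eventually_ge_atTop 2, Filter.eventually_ge_atTop (d * m)] with r h2 hr
    exact hXS.log_finrank_div_log_le k h2 hr
  · refine Module.Finite.of_surjective ℓ fun w => ?_
    obtain ⟨r, hr⟩ := hB w
    obtain ⟨W, -, hW⟩ := hℓ r hr
    exact ⟨W, hW⟩

section Presentation

variable (k : Type*) [Field k] (n : ℕ)

/-- The image of `x_i` in `E = (A # C_n)/(e₀)`. -/
noncomputable def xq (i : ZMod n) : Equot k n :=
  RingQuot.mkAlgHom k (fun a b : SkewGroup k n => a = e0 k n ∧ b = 0) (xg k n i)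

/-- The image of `s` in `E = (A # C_n)/(e₀)`. -/
noncomputable def sq : Equot k n :=
  RingQuot.mkAlgHom k (fun a b : SkewGroup k n => a = e0 k n ∧ b = 0) (sg k n)

theorem satisfiesRel_Equot [CharZero k] (hn : n ≠ 0) : SatisfiesRel (xq k n) (sq k n) where
  anti i j h := by
    have := RingQuot.mkAlgHom_rel k (SGRel.anti (k := k) i j h)
    rw [map_zero, map_add, map_mul, map_mul] at this
    have := congrArg (RingQuot.mkAlgHom k
      (fun a b : SkewGroup k n => a = e0 k n ∧ b = 0)) this
    rw [map_zero, map_add, map_mul, map_mul] at this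
    exact this
  spow := by
    have := RingQuot.mkAlgHom_rel k (SGRel.spow (k := k) (n := n))
    rw [map_one, map_pow] at this
    have := congrArg (RingQuot.mkAlgHom k
      (fun a b : SkewGroup k n => a = e0 k n ∧ b = 0)) this
    rw [map_one, map_pow] at this
    exact this
  scomm i := by
    have := RingQuot.mkAlgHom_rel k (SGRel.scomm (k := k) i)
    rw [map_mul, map_mul] at this
    have := congrArg (RingQuot.mkAlgHom k
      (fun a b : SkewGroup k n => a = e0 k n ∧ b = 0)) this
    rw [map_mul, map_mul] at this
    exact this
  ssum := by
    have h := RingQuot.mkAlgHom_rel k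
      (s := fun a b : SkewGroup k n => a = e0 k n ∧ b = 0) (x := e0 k n) (y := 0) ⟨rfl, rfl⟩
    have he : (n : k) • e0 k n = ∑ i ∈ Finset.range n, sg k n ^ i := by
      rw [e0, smul_smul, mul_inv_cancel₀ (Nat.cast_ne_zero.mpr hn), one_smul]
    have h' := congrArg (RingQuot.mkAlgHom k
      (fun a b : SkewGroup k n => a = e0 k n ∧ b = 0)) he
    rw [map_smul, h, map_zero, smul_zero, map_sum] at h'
    simp only [map_pow] at h'
    exact h'.symm

variable {k n}

/-- The universal property of `E = (A # C_n)/(e₀)`. -/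
theorem exists_algHom_Equot {B : Type*} [Ring B] [Algebra k B] {X : ZMod n → B} {S : B}
    (h : SatisfiesRel X S) :
    ∃ φ : Equot k n →ₐ[k] B, φ (sq k n) = S ∧ ∀ i, φ (xq k n i) = X i := by
  let f : FreeAlgebra k (ZMod n ⊕ Unit) →ₐ[k] B :=
    FreeAlgebra.lift k (Sum.elim X fun _ => S)
  have hf : ∀ ⦃a b⦄, SGRel k n a b → f a = f b := by
    rintro a b (⟨i, j, hij⟩ | _ | ⟨i⟩)
    · simpa [f] using h.anti i j hij
    · simpa [f] using h.spow
    · simpa [f] using h.scomm i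
  let g : SkewGroup k n →ₐ[k] B := RingQuot.liftAlgHom k ⟨f, hf⟩
  have hgs : g (sg k n) = S := by simp [g, sg, f]
  have hgx : ∀ i, g (xg k n i) = X i := fun i => by simp [g, xg, f]
  have hg : ∀ ⦃a b : SkewGroup k n⦄, a = e0 k n ∧ b = 0 → g a = g b := by
    rintro a b ⟨rfl, rfl⟩
    simp [e0, hgs, h.ssum]
  refine ⟨RingQuot.liftAlgHom k ⟨g, hg⟩, ?_, fun i => ?_⟩
  · simp [sq, hgs]
  · simp [xq, hgx]

theorem exists_mem_Vgen_pow (w : Equot k n) : ∃ r, w ∈ Vgen k n ^ r := by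
  obtain ⟨v, rfl⟩ := RingQuot.mkAlgHom_surjective k _ w
  obtain ⟨u, rfl⟩ := RingQuot.mkAlgHom_surjective k _ v
  have hone : (1 : Submodule k (Equot k n)) ≤ Vgen k n := 
    Submodule.one_le.mpr (Submodule.subset_span (Set.mem_insert _ _))
  induction u using FreeAlgebra.induction with
  | grade0 c =>
    refine ⟨0, ?_⟩
    rw [AlgHom.commutes, AlgHom.commutes, pow_zero]
    exact Submodule.mem_one.mpr ⟨c, rfl⟩
  | grade1 g =>
    refine ⟨1, ?_⟩
    rw [pow_one]
    rcases g with i | _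
    · exact Submodule.subset_span (.inr (.inr ⟨i, rfl⟩))
    · exact Submodule.subset_span (.inr (.inl rfl))
  | mul a b ha hb =>
    obtain ⟨r, hr⟩ := ha
    obtain ⟨t, ht⟩ := hb
    exact ⟨r + t, by rw [map_mul, map_mul, pow_add]; exact Submodule.mul_mem_mul hr ht⟩
  | add a b ha hb =>
    obtain ⟨r, hr⟩ := ha
    obtain ⟨t, ht⟩ := hb
    refine ⟨max r t, ?_⟩
    rw [map_add, map_add]
    exact add_mem (pow_le_pow_right' hone (le_max_left r t) hr)
      (pow_le_pow_right' hone (le_max_right r t) ht)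

end Presentation

end NCIS

open NCIS in
/-- Lemma 3.7: if `m ∣ n` with `2 ≤ m ≤ n`, then
`GKdim E⁽ⁿ⁾ ≥ GKdim E⁽ᵐ⁾`; in particular if `E⁽ⁿ⁾` is finite-dimensional then so is `E⁽ᵐ⁾`. -/
theorem gkdim_skewGroup_quotient_ge_of_dvd
    (k : Type*) [Field k] [IsAlgClosed k] [CharZero k]
    (n m : ℕ) (hm2 : 2 ≤ m) (hmn : m ≤ n) (hdvd : m ∣ n) :
    gkdim k (Equot k m) (Vgen k m) ≤ gkdim k (Equot k n) (Vgen k n) ∧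
      (FiniteDimensional k (Equot k n) → FiniteDimensional k (Equot k m)) := by
  obtain ⟨d, rfl⟩ := hdvd
  have hm : 0 < m := by omega
  have hd : 0 < d := Nat.pos_of_ne_zero (by rintro rfl; omega)
  rw [mul_comm m d]
  have hrel := satisfiesRel_Equot k m hm.ne'
  obtain ⟨φ, hs, hx⟩ := exists_algHom_Equot (k := k) (hrel.induced hd hm)
  exact gkdim_le_of_inducedRepresentation hd hm
    (satisfiesRel_Equot k (d * m) (Nat.mul_pos hd hm).ne') exists_mem_Vgen_pow φ hs hx
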